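/- Let O(Σ) = {g ∈ O(4,ℝ) : g(Σ) = Σ} and let O(4,ℛ) be the group of orthogonal linear maps of ℝ⁴ whose matrix in the standard basis has all entries in ℛ. Then: (i) O(Σ) = O(4,ℛ); (ii) O(4,ℛ) is generated by H∞ together with ι, and ι ∉ H∞; (iii) H∞ is a subgroup of index 2 in O(4,ℛ). -/

import Mathlib

noncomputable section

/-- The golden ratio τ = (1+√5)/2. -/
def gr : ℝ := (1 + Real.sqrt 5) / 2

/-- ℛ = ℤ[1/2, τ], the ring of dyadic golden numbers, as a subset of ℝ. -/
def Rgold : Set ℝ := {x : ℝ | ∃ (a b : ℤ) (n : ℕ), x = ((a : ℝ) + (b : ℝ) * gr) / 2 ^ n}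

/-- The H₄ root system with parameter t (t = τ gives Δ, t = 1-τ = τ' gives Δ'). -/
def DeltaSet (t : ℝ) : Set (Fin 4 → ℝ) :=
  {x | (∃ i, (x i = 1 ∨ x i = -1) ∧ ∀ j, j ≠ i → x j = 0)
    ∨ (∀ i, x i = 1/2 ∨ x i = -1/2)
    ∨ (∃ σ : Equiv.Perm (Fin 4), Equiv.Perm.sign σ = 1 ∧
        ∃ ε : Fin 4 → ℝ, (∀ i, ε i = 1 ∨ ε i = -1) ∧
          ∀ i, x i = ε i * (![0, 1, 1 - t, t] (σ i)) / 2)}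

/-- The matrix of the reflection `x ↦ x - 2(x·a)a` in the standard basis. -/
def reflMat (a : Fin 4 → ℝ) : Matrix (Fin 4) (Fin 4) ℝ :=
  Matrix.of fun i j => (if i = j then (1 : ℝ) else 0) - 2 * a i * a j

/-- H∞, the subgroup of O(4,ℝ) generated by the reflections in the roots of Δ ∪ Δ'. -/
def HinfG : Subgroup (Matrix.orthogonalGroup (Fin 4) ℝ) :=
  Subgroup.closure {g | ∃ a ∈ DeltaSet gr ∪ DeltaSet (1 - gr),
    (g : Matrix (Fin 4) (Fin 4) ℝ) = reflMat a}

/-- Σ, the orbit of Δ ∪ Δ' under H∞. -/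
def SigmaSet : Set (Fin 4 → ℝ) :=
  {x | ∃ g ∈ HinfG, ∃ a ∈ DeltaSet gr ∪ DeltaSet (1 - gr),
    x = Matrix.mulVec (g : Matrix (Fin 4) (Fin 4) ℝ) a}

/-- The matrix of ι, the map interchanging the last two coordinates. -/
def iotaM : Matrix (Fin 4) (Fin 4) ℝ :=
  !![1, 0, 0, 0; 0, 1, 0, 0; 0, 0, 0, 1; 0, 0, 1, 0]

/-- O(Σ) = {g ∈ O(4,ℝ) : g(Σ) = Σ}. -/
def OSigma : Set (Matrix.orthogonalGroup (Fin 4) ℝ) :=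
  {g | (fun x => Matrix.mulVec (g : Matrix (Fin 4) (Fin 4) ℝ) x) '' SigmaSet = SigmaSet}

/-- O(4,ℛ): orthogonal matrices all of whose entries lie in ℛ. -/
def O4R : Set (Matrix.orthogonalGroup (Fin 4) ℝ) :=
  {g | ∀ i j, (g : Matrix (Fin 4) (Fin 4) ℝ) i j ∈ Rgold}

/-! ### The ring of dyadic golden numbers -/

theorem gr_sq : gr * gr = gr + 1 := by
  have h : Real.sqrt 5 * Real.sqrt 5 = 5 := Real.mul_self_sqrt (by norm_num)
  unfold gr
  linear_combination h / 4

theorem gr_irrational : Irrational gr := Real.goldenRatio_irrational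

theorem int_add_int_mul_gr_eq_zero {a b : ℤ} (h : (a : ℝ) + b * gr = 0) : a = 0 ∧ b = 0 := by
  have hb : b = 0 := by
    by_contra hb
    refine ((gr_irrational.intCast_mul hb).ne_int (-a)) ?_
    push_cast
    linear_combination h
  subst hb
  simpa using h

/-- `Rgold` as a subring of the reals. -/
def goldSubring : Subring ℝ where
  carrier := Rgold
  zero_mem' := ⟨0, 0, 0, by simp⟩
  one_mem' := ⟨1, 0, 0, by simp⟩
  neg_mem' := by
    rintro _ ⟨a, b, n, rfl⟩
    exact ⟨-a, -b, n, by push_cast; ring⟩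
  add_mem' := by
    rintro _ _ ⟨a, b, n, rfl⟩ ⟨c, d, m, rfl⟩
    refine ⟨a * 2 ^ m + c * 2 ^ n, b * 2 ^ m + d * 2 ^ n, n + m, ?_⟩
    push_cast
    rw [pow_add]
    field_simp
    ring
  mul_mem' := by
    rintro _ _ ⟨a, b, n, rfl⟩ ⟨c, d, m, rfl⟩
    refine ⟨a * c + b * d, a * d + b * c + b * d, n + m, ?_⟩
    push_cast
    rw [pow_add]
    field_simp
    linear_combination (b * d : ℝ) * gr_sq

theorem gr_mem_goldSubring : gr ∈ goldSubring := ⟨0, 1, 0, by simp⟩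

theorem half_mem_goldSubring : (1 / 2 : ℝ) ∈ goldSubring := ⟨1, 0, 1, by simp⟩

theorem two_mul_self_ne_one_of_mem {y : ℝ} (hy : y ∈ goldSubring) : 2 * (y * y) ≠ 1 := by
  obtain ⟨p, q, n, rfl⟩ := hy
  intro h
  have h2 : (2 : ℝ) ^ n ≠ 0 := by positivity
  field_simp at h
  have h0 : ((2 * (p * p + q * q) - (2 ^ n) ^ 2 : ℤ) : ℝ) +
      ((2 * (2 * p * q + q * q) : ℤ) : ℝ) * gr = 0 := by
    push_cast
    linear_combination h - 2 * (q : ℝ) * q * gr_sq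
  obtain ⟨h3, h4⟩ := int_add_int_mul_gr_eq_zero h0
  have h5 : q * (2 * p + q) = 0 := by linarith
  rcases mul_eq_zero.mp h5 with rfl | h6
  · have hp : (p : ℝ) ≠ 0 := by
      rintro hp
      have : p = 0 := by exact_mod_cast hp
      subst this
      have : ((2 : ℤ) ^ n) ^ 2 ≠ 0 := by positivity
      omega
    have h7 : (2 : ℝ) * (p * p) = (2 ^ n) ^ 2 := by
      have : (2 : ℤ) * (p * p) = (2 ^ n) ^ 2 := by linarith
      exact_mod_cast this
    have h8 : (2 : ℝ) = (2 ^ n / |(p : ℝ)|) ^ 2 := by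
      rw [div_pow, sq_abs]
      field_simp
      linarith
    apply irrational_sqrt_two.ne_rat ((2 ^ n : ℚ) / |(p : ℚ)|)
    push_cast
    conv_lhs => rw [h8]
    exact Real.sqrt_sq (by positivity)
  · obtain rfl : q = -2 * p := by linarith
    have h7 : (2 : ℤ) ^ (2 * n) = 5 * (2 * p ^ 2) := by
      rw [mul_comm 2 n, pow_mul]
      linarith
    have h8 : (5 : ℤ) ∣ 2 := Int.Prime.dvd_pow' (by norm_num) (h7 ▸ Dvd.intro _ rfl)
    norm_num at h8

/-! ### Roots and reflections -/

/-- The union of the two root systems `Δ` and `Δ'`. -/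
def rootSet : Set (Fin 4 → ℝ) := DeltaSet gr ∪ DeltaSet (1 - gr)

theorem single_mem_rootSet (i : Fin 4) : Pi.single i (1 : ℝ) ∈ rootSet :=
  Or.inl (Or.inl ⟨i, by simp, fun j hj => by simp [hj]⟩)

theorem signed_perm_mem_rootSet (σ : Equiv.Perm (Fin 4)) (ε : Fin 4 → ℝ)
    (hε : ∀ i, ε i = 1 ∨ ε i = -1) :
    (fun i => ε i * (![0, 1, 1 - gr, gr] (σ i)) / 2) ∈ rootSet := by
  rcases Int.units_eq_one_or (Equiv.Perm.sign σ) with h | h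
  · exact Or.inl (Or.inr (Or.inr ⟨σ, h, ε, hε, fun i => rfl⟩))
  · refine Or.inr (Or.inr (Or.inr ⟨Equiv.swap 2 3 * σ, ?_, ε, hε, fun i => ?_⟩))
    · rw [Equiv.Perm.sign_mul, h, Equiv.Perm.sign_swap (by decide)]
      simp
    · have : ∀ j : Fin 4, ![0, 1, 1 - gr, gr] j =
          ![0, 1, 1 - (1 - gr), 1 - gr] (Equiv.swap 2 3 j) := by
        intro j
        fin_cases j
        · rfl
        · rfl
        · simp [show Equiv.swap (2 : Fin 4) 3 2 = 3 from rfl]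
        · simp [show Equiv.swap (2 : Fin 4) 3 3 = 2 from rfl]
      simp only [this, Equiv.Perm.mul_apply]

theorem deltaSet_norm {t : ℝ} (ht : t * t = t + 1) {x : Fin 4 → ℝ} (hx : x ∈ DeltaSet t) :
    ∑ i, x i * x i = 1 := by
  rcases hx with ⟨i, hi, hj⟩ | hx | ⟨σ, -, ε, hε, hx⟩
  · rw [Finset.sum_eq_single i (fun j _ hji => by simp [hj j hji]) (by simp)]
    rcases hi with hi | hi <;> simp [hi]
  · have : ∀ i, x i * x i = 1 / 4 := fun i => by rcases hx i with h | h <;> rw [h] <;> norm_num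
    simp [this]
  · have : ∀ i, x i * x i = (fun j => (![0, 1, 1 - t, t] j) ^ 2 / 4) (σ i) := fun i => by
      rw [hx]
      rcases hε i with h | h <;> rw [h] <;> ring
    rw [Finset.sum_congr rfl (fun i _ => this i),
      Equiv.sum_comp σ (fun j => (![0, 1, 1 - t, t] j) ^ 2 / 4)]
    simp [Fin.sum_univ_four]
    linear_combination ht / 2

theorem deltaSet_mem {t : ℝ} (ht : t ∈ goldSubring) {x : Fin 4 → ℝ} (hx : x ∈ DeltaSet t)
    (i : Fin 4) : x i ∈ goldSubring := by
  have hs : ∀ {y : ℝ}, y = 1 ∨ y = -1 → y ∈ goldSubring := by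
    rintro y (rfl | rfl)
    · exact one_mem _
    · exact neg_mem (one_mem _)
  rcases hx with ⟨k, hk, hj⟩ | hx | ⟨σ, -, ε, hε, hx⟩
  · by_cases h : i = k
    · subst h
      exact hs hk
    · rw [hj i h]
      exact zero_mem _
  · rcases hx i with h | h <;> rw [h]
    · exact half_mem_goldSubring
    · rw [neg_div]
      exact neg_mem half_mem_goldSubring
  · rw [hx, div_eq_mul_one_div]
    refine mul_mem (mul_mem (hs (hε i)) ?_) half_mem_goldSubring
    generalize σ i = j
    fin_cases j
    · exact zero_mem _
    · exact one_mem _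
    · exact sub_mem (one_mem _) ht
    · exact ht

theorem rootSet_norm {x : Fin 4 → ℝ} (hx : x ∈ rootSet) : ∑ i, x i * x i = 1 := by
  rcases hx with hx | hx
  · exact deltaSet_norm gr_sq hx
  · exact deltaSet_norm (by linear_combination gr_sq) hx

theorem rootSet_mem {x : Fin 4 → ℝ} (hx : x ∈ rootSet) (i : Fin 4) : x i ∈ goldSubring := by
  rcases hx with hx | hx
  · exact deltaSet_mem gr_mem_goldSubring hx i
  · exact deltaSet_mem (sub_mem (one_mem _) gr_mem_goldSubring) hx i

theorem reflMat_mulVec (a v : Fin 4 → ℝ) (i : Fin 4) :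
    (reflMat a).mulVec v i = v i - 2 * (∑ j, a j * v j) * a i := by
  simp only [reflMat, Matrix.mulVec, dotProduct, Matrix.of_apply, Fin.sum_univ_four]
  fin_cases i <;> simp <;> ring

theorem reflMat_mulVec_of_eq_zero {a : Fin 4 → ℝ} {i : Fin 4} (h : a i = 0) :
    (reflMat a).mulVec (Pi.single i 1) = Pi.single i 1 := by
  funext j
  rw [reflMat_mulVec]
  simp [Pi.single_apply, h]

theorem reflMat_mem_orthogonalGroup {a : Fin 4 → ℝ} (ha : ∑ i, a i * a i = 1) :
    reflMat a ∈ Matrix.orthogonalGroup (Fin 4) ℝ := by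
  rw [Matrix.mem_orthogonalGroup_iff]
  have hT : (reflMat a).transpose = reflMat a := by
    ext i j
    simp only [reflMat, Matrix.transpose_apply, Matrix.of_apply, eq_comm (a := j)]
    ring
  rw [hT]
  have : ∀ v, (reflMat a * reflMat a).mulVec v = (1 : Matrix _ _ ℝ).mulVec v := by
    intro v
    rw [← Matrix.mulVec_mulVec, Matrix.one_mulVec]
    funext i
    simp only [reflMat_mulVec, Fin.sum_univ_four] at ha ⊢
    linear_combination (4 * a i * (a 0 * v 0 + a 1 * v 1 + a 2 * v 2 + a 3 * v 3)) * ha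
  exact Matrix.ext_of_mulVec_single fun i => this _

theorem exists_mem_HinfG_reflMat {a : Fin 4 → ℝ} (ha : a ∈ rootSet) :
    ∃ h ∈ HinfG, (h : Matrix (Fin 4) (Fin 4) ℝ) = reflMat a :=
  ⟨⟨reflMat a, reflMat_mem_orthogonalGroup (rootSet_norm ha)⟩,
    Subgroup.subset_closure ⟨a, ha, rfl⟩, rfl⟩

/-! ### Integral vectors over `ℤ[τ]` and the descent on denominators -/

/-- The vector with coordinates `(aᵢ + bᵢ τ) / 2 ^ n`. -/
def goldVec (a b : Fin 4 → ℤ) (n : ℕ) : Fin 4 → ℝ := fun i => ((a i : ℝ) + b i * gr) / 2 ^ n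

/-- The rational parts of `0, 1, τ', τ`. -/
def rootA : Fin 4 → ℤ := ![0, 1, 1, 0]

/-- The `τ`-parts of `0, 1, τ', τ`. -/
def rootB : Fin 4 → ℤ := ![0, 0, -1, 1]

theorem rootA_add_rootB_mul_gr (j : Fin 4) :
    (![0, 1, 1 - gr, gr] j : ℝ) = rootA j + rootB j * gr := by
  fin_cases j <;> simp [rootA, rootB, sub_eq_add_neg]

/-- Reflecting `A / 2 ^ n` in the root `α / 2` gives `(A - sα) / 2 ^ n`, where `A · α = 2s`. -/
theorem reflMat_mulVec_goldVec (a b : Fin 4 → ℤ) (n : ℕ) (σ : Equiv.Perm (Fin 4))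
    (ε : Fin 4 → ℤ) (s t : ℤ)
    (hs : ∑ i, ε i * (a i * rootA (σ i) + b i * rootB (σ i)) = 2 * s)
    (ht : ∑ i, ε i * (a i * rootB (σ i) + b i * rootA (σ i) + b i * rootB (σ i)) = 2 * t) :
    (reflMat fun i => ε i * (![0, 1, 1 - gr, gr] (σ i)) / 2).mulVec (goldVec a b n) =
      goldVec (fun i => a i - ε i * (s * rootA (σ i) + t * rootB (σ i)))
        (fun i => b i - ε i * (s * rootB (σ i) + t * rootA (σ i) + t * rootB (σ i))) n := by
  funext i
  rw [reflMat_mulVec]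
  have hst : ∑ j, (ε j * (![0, 1, 1 - gr, gr] (σ j)) / 2) * goldVec a b n j =
      (s + t * gr) / 2 ^ n := by
    have hs' : ∑ j, (ε j : ℝ) * (a j * rootA (σ j) + b j * rootB (σ j)) = 2 * s := by
      exact_mod_cast hs
    have ht' : ∑ j, (ε j : ℝ) * (a j * rootB (σ j) + b j * rootA (σ j) + b j * rootB (σ j)) =
        2 * t := by
      exact_mod_cast ht
    have : ∀ j, (ε j * (![0, 1, 1 - gr, gr] (σ j)) / 2) * goldVec a b n j =
        ((ε j : ℝ) * (a j * rootA (σ j) + b j * rootB (σ j)) +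
          (ε j : ℝ) * (a j * rootB (σ j) + b j * rootA (σ j) + b j * rootB (σ j)) * gr) *
            (1 / (2 * 2 ^ n)) := by
      intro j
      rw [rootA_add_rootB_mul_gr, goldVec]
      field_simp
      linear_combination (ε j * rootB (σ j) * b j : ℝ) * gr_sq
    simp only [this]
    rw [← Finset.sum_mul, Finset.sum_add_distrib, ← Finset.sum_mul, hs', ht']
    field_simp
  rw [hst]
  simp only [rootA_add_rootB_mul_gr, goldVec]
  push_cast
  field_simp
  linear_combination -(ε i * rootB (σ i) * t : ℝ) * gr_sq

/-- Flipping at most one sign moves `A · α / 2` to any prescribed residue class modulo `2`, provided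
the products `Aᵢ αᵢ` run through the nonzero classes. -/
theorem exists_signs_of_residues (a b : Fin 4 → ℤ) (x y : ℤ) (S T : ℤ)
    (hS : a 1 + (a 2 - b 2) + b 3 = 2 * S) (hT : b 1 - a 2 + (a 3 + b 3) = 2 * T)
    (h : (2 ∣ S - x ∧ 2 ∣ T - y) ∨ (2 ∣ S - a 1 - x ∧ 2 ∣ T - b 1 - y) ∨
      (2 ∣ S - (a 2 - b 2) - x ∧ 2 ∣ T + a 2 - y) ∨
      (2 ∣ S - b 3 - x ∧ 2 ∣ T - (a 3 + b 3) - y)) :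
    ∃ ε : Fin 4 → ℤ, (∀ j, ε j = 1 ∨ ε j = -1) ∧ ∃ s t : ℤ,
      ∑ j, ε j * (a j * rootA j + b j * rootB j) = 2 * s ∧
      ∑ j, ε j * (a j * rootB j + b j * rootA j + b j * rootB j) = 2 * t ∧
      2 ∣ s - x ∧ 2 ∣ t - y := by
  rcases h with h | h | h | h
  · refine ⟨![1, 1, 1, 1], by simp [Fin.forall_fin_succ], S, T, ?_⟩
    simp [Fin.sum_univ_four, rootA, rootB]
    omega
  · refine ⟨![1, -1, 1, 1], by simp [Fin.forall_fin_succ], S - a 1, T - b 1, ?_⟩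
    simp [Fin.sum_univ_four, rootA, rootB]
    omega
  · refine ⟨![1, 1, -1, 1], by simp [Fin.forall_fin_succ], S - (a 2 - b 2), T + a 2, ?_⟩
    simp [Fin.sum_univ_four, rootA, rootB]
    omega
  · refine ⟨![1, 1, 1, -1], by simp [Fin.forall_fin_succ], S - b 3, T - (a 3 + b 3), ?_⟩
    simp [Fin.sum_univ_four, rootA, rootB]
    omega

theorem exists_signs_of_residues_perm (a b : Fin 4 → ℤ)
    (ha : ∀ j, 2 ∣ a j - rootA j) (hb : ∀ j, 2 ∣ b j - rootB j) :
    ∃ ε : Fin 4 → ℤ, (∀ j, ε j = 1 ∨ ε j = -1) ∧ ∃ s t : ℤ,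
      ∑ j, ε j * (a j * rootA j + b j * rootB j) = 2 * s ∧
      ∑ j, ε j * (a j * rootB j + b j * rootA j + b j * rootB j) = 2 * t ∧
      ∀ j, 2 ∣ a j - ε j * (s * rootA j + t * rootB j) ∧
        2 ∣ b j - ε j * (s * rootB j + t * rootA j + t * rootB j) := by
  simp [Fin.forall_fin_succ, rootA, rootB] at ha hb
  obtain ⟨ε, hε, s, t, hs, ht, h1, h2⟩ := exists_signs_of_residues a b 1 0
    ((a 1 + (a 2 - b 2) + b 3) / 2) ((b 1 - a 2 + (a 3 + b 3)) / 2)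
    (by omega) (by omega) (by omega)
  refine ⟨ε, hε, s, t, hs, ht, ?_⟩
  have hε1 := hε 1
  have hε2 := hε 2
  have hε3 := hε 3
  simp only [Fin.forall_fin_succ, rootA, rootB]
  simp
  rcases hε1 with e1 | e1 <;> rcases hε2 with e2 | e2 <;> rcases hε3 with e3 | e3 <;>
    simp only [e1, e2, e3] <;> omega

theorem exists_signs_of_residues_const (a b : Fin 4 → ℤ) (x y : ℤ) (hxy : ¬ (2 ∣ x ∧ 2 ∣ y))
    (ha : ∀ j, 2 ∣ a j - x) (hb : ∀ j, 2 ∣ b j - y) :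
    ∃ ε : Fin 4 → ℤ, (∀ j, ε j = 1 ∨ ε j = -1) ∧ ∃ s t : ℤ,
      ∑ j, ε j * (a j * rootA j + b j * rootB j) = 2 * s ∧
      ∑ j, ε j * (a j * rootB j + b j * rootA j + b j * rootB j) = 2 * t ∧
      2 ∣ a 1 - ε 1 * (s * rootA 1 + t * rootB 1) ∧
        2 ∣ b 1 - ε 1 * (s * rootB 1 + t * rootA 1 + t * rootB 1) := by
  simp [Fin.forall_fin_succ] at ha hb
  have hflip : ∀ S T : ℤ, (2 ∣ S - x ∧ 2 ∣ T - y) ∨ (2 ∣ S - a 1 - x ∧ 2 ∣ T - b 1 - y) ∨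
      (2 ∣ S - (a 2 - b 2) - x ∧ 2 ∣ T + a 2 - y) ∨
      (2 ∣ S - b 3 - x ∧ 2 ∣ T - (a 3 + b 3) - y) := by
    intro S T
    rcases Int.emod_two_eq x with hx | hx <;> rcases Int.emod_two_eq y with hy | hy <;>
      rcases Int.emod_two_eq S with hS | hS <;> rcases Int.emod_two_eq T with hT | hT <;>
      first
      | (exfalso; omega)
      | exact Or.inl (by omega)
      | exact Or.inr (Or.inl (by omega))
      | exact Or.inr (Or.inr (Or.inl (by omega)))
      | exact Or.inr (Or.inr (Or.inr (by omega)))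
  obtain ⟨ε, hε, s, t, hs, ht, h1, h2⟩ := exists_signs_of_residues a b x y
    ((a 1 + (a 2 - b 2) + b 3) / 2) ((b 1 - a 2 + (a 3 + b 3)) / 2)
    (by omega) (by omega) (hflip _ _)
  refine ⟨ε, hε, s, t, hs, ht, ?_⟩
  simp only [rootA, rootB]
  simp
  rcases hε 1 with e | e <;> simp only [e] <;> omega

theorem residues_of_sum_sq (r s : Fin 4 → Fin 2)
    (h1 : (∑ i, ((r i).val + (s i).val)) % 4 = 0)
    (h2 : (∑ i, (2 * (r i).val * (s i).val + (s i).val)) % 4 = 0) :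
    (∀ i, r i = 0 ∧ s i = 0) ∨
    ((∀ i, r i = r 0 ∧ s i = s 0) ∧ ¬ (r 0 = 0 ∧ s 0 = 0)) ∨
    ∃ σ : Equiv.Perm (Fin 4), ∀ i, r i = ![0, 1, 1, 0] (σ i) ∧ s i = ![0, 0, 1, 1] (σ i) := by
  revert r s
  decide

theorem goldVec_sum_sq {a b : Fin 4 → ℤ} {n : ℕ}
    (h : ∑ i, goldVec a b n i * goldVec a b n i = 1) :
    ∑ i, (a i ^ 2 + b i ^ 2) = 4 ^ n ∧ ∑ i, (2 * a i * b i + b i ^ 2) = 0 := by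
  have h4 : (4 : ℝ) ^ n = 2 ^ n * 2 ^ n := by rw [← mul_pow]; norm_num
  have h0 : ((∑ i, (a i ^ 2 + b i ^ 2) - 4 ^ n : ℤ) : ℝ) +
      ((∑ i, (2 * a i * b i + b i ^ 2) : ℤ) : ℝ) * gr = 0 := by
    have : ∀ i, goldVec a b n i * goldVec a b n i =
        (((a i : ℝ) ^ 2 + (b i : ℝ) ^ 2) + (2 * a i * b i + (b i : ℝ) ^ 2) * gr) *
          (1 / 4 ^ n) := by
      intro i
      rw [goldVec, h4]
      field_simp
      linear_combination ((b i : ℝ) ^ 2) * gr_sq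
    simp only [this] at h
    rw [← Finset.sum_mul, Finset.sum_add_distrib, ← Finset.sum_mul] at h
    rw [mul_one_div, div_eq_one_iff_eq (by positivity)] at h
    push_cast
    linear_combination h
  obtain ⟨h1, h2⟩ := int_add_int_mul_gr_eq_zero h0
  exact ⟨by linarith, h2⟩

theorem goldVec_residues {a b : Fin 4 → ℤ} {n : ℕ}
    (h : ∑ i, goldVec a b (n + 1) i * goldVec a b (n + 1) i = 1) :
    (∀ i, 2 ∣ a i ∧ 2 ∣ b i) ∨
    (∃ x y : ℤ, ¬ (2 ∣ x ∧ 2 ∣ y) ∧ ∀ i, 2 ∣ a i - x ∧ 2 ∣ b i - y) ∨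
    ∃ σ : Equiv.Perm (Fin 4), ∀ i, 2 ∣ a i - rootA (σ i) ∧ 2 ∣ b i - rootB (σ i) := by
  obtain ⟨h1, h2⟩ := goldVec_sum_sq h
  have key : ∀ z : ℤ, ∃ r : Fin 2, ∃ k : ℤ, z = 2 * k + r.val := fun z => by
    rcases Int.even_or_odd' z with ⟨k, hk | hk⟩
    · exact ⟨0, k, by simpa using hk⟩
    · exact ⟨1, k, by simpa using hk⟩
  choose r k hk using fun i => key (a i)
  choose s l hl using fun i => key (b i)
  have hsq : ∀ u : Fin 2, (u.val : ℤ) ^ 2 = u.val := by decide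
  have e1 : ∀ i, (4 : ℤ) ∣ (a i ^ 2 + b i ^ 2) - (((r i).val + (s i).val : ℕ) : ℤ) := by
    intro i
    refine ⟨k i ^ 2 + k i * (r i).val + l i ^ 2 + l i * (s i).val, ?_⟩
    push_cast
    rw [hk i, hl i]
    linear_combination hsq (r i) + hsq (s i)
  have e2 : ∀ i, (4 : ℤ) ∣ (2 * a i * b i + b i ^ 2) -
      ((2 * (r i).val * (s i).val + (s i).val : ℕ) : ℤ) := by
    intro i
    refine ⟨2 * k i * l i + k i * (s i).val + l i * (r i).val + l i ^ 2 + l i * (s i).val, ?_⟩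
    push_cast
    rw [hk i, hl i]
    linear_combination hsq (s i)
  have f1 := Finset.dvd_sum fun i (_ : i ∈ Finset.univ) => e1 i
  have f2 := Finset.dvd_sum fun i (_ : i ∈ Finset.univ) => e2 i
  rw [Finset.sum_sub_distrib, ← Nat.cast_sum] at f1 f2
  rw [h1, pow_succ] at f1
  rw [h2] at f2
  rcases residues_of_sum_sq r s (by omega) (by omega) with h | ⟨h, h'⟩ | ⟨σ, h⟩
  · left
    intro i
    rw [hk i, hl i, (h i).1, (h i).2]
    simp
  · right; left
    refine ⟨(r 0).val, (s 0).val, ?_, fun i => ?_⟩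
    · rintro ⟨d1, d2⟩
      apply h'
      constructor <;> apply Fin.ext <;> simp <;> omega
    · rw [hk i, hl i, (h i).1, (h i).2]
      simp
  · right; right
    refine ⟨σ, fun i => ?_⟩
    rw [hk i, hl i, (h i).1, (h i).2]
    generalize σ i = j
    fin_cases j <;> simp [rootA, rootB]
    omega

/-! ### The action on unit vectors -/

theorem mul_mulVec (g h : Matrix.orthogonalGroup (Fin 4) ℝ) (v : Fin 4 → ℝ) :
    (g * h).1.mulVec v = g.1.mulVec (h.1.mulVec v) :=
  (Matrix.mulVec_mulVec v g.1 h.1).symm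

theorem mulVec_dotProduct_mulVec (g : Matrix.orthogonalGroup (Fin 4) ℝ) (v w : Fin 4 → ℝ) :
    g.1.mulVec v ⬝ᵥ g.1.mulVec w = v ⬝ᵥ w := by
  have h : g.1.transpose * g.1 = 1 := (Matrix.mem_orthogonalGroup_iff' _ _).mp g.2
  rw [Matrix.dotProduct_mulVec, ← Matrix.mulVec_transpose, Matrix.mulVec_mulVec, h,
    Matrix.one_mulVec]

theorem apply_eq_zero_of_mulVec {g : Matrix.orthogonalGroup (Fin 4) ℝ} {v : Fin 4 → ℝ}
    {i : Fin 4} (hi : g.1.mulVec (Pi.single i 1) = Pi.single i 1) (hv : v i = 0) :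
    g.1.mulVec v i = 0 := by
  have := mulVec_dotProduct_mulVec g v (Pi.single i 1)
  rwa [hi, dotProduct_single_one, dotProduct_single_one, hv] at this

theorem exists_mulVec_goldVec_of_perm {a b : Fin 4 → ℤ} {n : ℕ} (σ : Equiv.Perm (Fin 4))
    (hσ : ∀ i, 2 ∣ a i - rootA (σ i) ∧ 2 ∣ b i - rootB (σ i)) :
    ∃ h ∈ HinfG, ∃ c d, h.1.mulVec (goldVec a b (n + 1)) = goldVec c d n ∧
      ∀ i, goldVec a b (n + 1) i = 0 → h.1.mulVec (Pi.single i 1) = Pi.single i 1 := by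
  obtain ⟨ε, hε, s, t, hs, ht, hdvd⟩ := exists_signs_of_residues_perm (a ∘ σ.symm) (b ∘ σ.symm)
    (fun j => by simpa using (hσ (σ.symm j)).1) (fun j => by simpa using (hσ (σ.symm j)).2)
  rw [← Equiv.sum_comp σ] at hs ht
  simp only [Function.comp_apply, Equiv.symm_apply_apply] at hs ht
  have hdvd' := fun i => hdvd (σ i)
  simp only [Function.comp_apply, Equiv.symm_apply_apply] at hdvd'
  choose hc hd using hdvd'
  choose c hc using hc
  choose d hd using hd
  obtain ⟨h, hH, hh⟩ := exists_mem_HinfG_reflMat (signed_perm_mem_rootSet σ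
    (fun i => (ε (σ i) : ℝ)) (fun i => by rcases hε (σ i) with e | e <;> simp [e]))
  refine ⟨h, hH, c, d, ?_, fun i hi => ?_⟩
  · rw [hh, reflMat_mulVec_goldVec a b _ σ (fun i => ε (σ i)) s t hs ht]
    simp only [hc, hd]
    funext i
    simp only [goldVec]
    push_cast
    field_simp
    ring
  · rw [hh]
    apply reflMat_mulVec_of_eq_zero
    have hab : a i = 0 ∧ b i = 0 := by
      apply int_add_int_mul_gr_eq_zero
      simpa [goldVec] using hi
    have := hσ i
    rw [hab.1, hab.2] at this
    have hσi : σ i = 0 := by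
      revert this
      generalize σ i = j
      revert j
      decide
    simp [hσi]

theorem sum_mulVec_mul_self (g : Matrix.orthogonalGroup (Fin 4) ℝ) {v : Fin 4 → ℝ}
    (hv : ∑ i, v i * v i = 1) : ∑ i, g.1.mulVec v i * g.1.mulVec v i = 1 :=
  (mulVec_dotProduct_mulVec g v v).trans hv

theorem exists_mulVec_goldVec {a b : Fin 4 → ℤ} {n : ℕ}
    (h : ∑ i, goldVec a b (n + 1) i * goldVec a b (n + 1) i = 1) :
    ∃ h ∈ HinfG, ∃ c d, h.1.mulVec (goldVec a b (n + 1)) = goldVec c d n ∧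
      ∀ i, goldVec a b (n + 1) i = 0 → h.1.mulVec (Pi.single i 1) = Pi.single i 1 := by
  have halve : ∀ {a b : Fin 4 → ℤ}, (∀ i, 2 ∣ a i ∧ 2 ∣ b i) →
      ∃ c d, goldVec a b (n + 1) = goldVec c d n := by
    intro a b hab
    choose hc hd using hab
    choose c hc using hc
    choose d hd using hd
    refine ⟨c, d, ?_⟩
    funext i
    simp only [goldVec, hc, hd]
    push_cast
    field_simp
    ring
  rcases goldVec_residues h with h0 | ⟨x, y, hxy, hab⟩ | ⟨σ, hσ⟩
  · obtain ⟨c, d, hcd⟩ := halve h0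
    exact ⟨1, one_mem _, c, d, (Matrix.one_mulVec _).trans hcd,
      fun i _ => Matrix.one_mulVec _⟩
  · obtain ⟨ε, hε, s, t, hs, ht, h1, h2⟩ := exists_signs_of_residues_const a b x y hxy
      (fun j => (hab j).1) (fun j => (hab j).2)
    obtain ⟨h', hH, hh⟩ := exists_mem_HinfG_reflMat (signed_perm_mem_rootSet 1
      (fun i => (ε i : ℝ)) (fun i => by rcases hε i with e | e <;> simp [e]))
    have hne : ∀ i, goldVec a b (n + 1) i ≠ 0 := by
      intro i hi
      have hab' : a i = 0 ∧ b i = 0 := by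
        apply int_add_int_mul_gr_eq_zero
        simpa [goldVec] using hi
      have := hab i
      omega
    have hv := reflMat_mulVec_goldVec a b (n + 1) 1 ε s t hs ht
    rw [← hh] at hv
    have hu := sum_mulVec_mul_self h' h
    rw [hv] at hu
    rcases goldVec_residues hu with h0 | ⟨x', y', hxy', hab'⟩ | ⟨σ, hσ⟩
    · obtain ⟨c, d, hcd⟩ := halve h0
      exact ⟨h', hH, c, d, hv.trans hcd, fun i hi => absurd hi (hne i)⟩
    · have := hab' 1
      simp only [Equiv.Perm.one_apply] at this
      omega
    · obtain ⟨k, hk, c, d, hcd, -⟩ := exists_mulVec_goldVec_of_perm (n := n) σ hσ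
      refine ⟨k * h', mul_mem hk hH, c, d, ?_, fun i hi => absurd hi (hne i)⟩
      rw [mul_mulVec, hv, hcd]
  · exact exists_mulVec_goldVec_of_perm σ hσ

/-- An integral unit vector is, up to sign, a vector of the standard basis. -/
theorem exists_mulVec_goldVec_zero {a b : Fin 4 → ℤ}
    (h : ∑ i, goldVec a b 0 i * goldVec a b 0 i = 1) :
    ∃ h ∈ HinfG, ∃ j, h.1.mulVec (goldVec a b 0) = Pi.single j 1 ∧
      ∀ i, goldVec a b 0 i = 0 → h.1.mulVec (Pi.single i 1) = Pi.single i 1 := by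
  obtain ⟨h1, h2⟩ := goldVec_sum_sq h
  have hsingle : ∃ j, (a j = 1 ∨ a j = -1) ∧ b j = 0 ∧ ∀ i, i ≠ j → a i = 0 ∧ b i = 0 := by
    obtain ⟨j, -, hj⟩ := Finset.exists_ne_zero_of_sum_ne_zero
      (h1.trans_ne (by norm_num))
    have hpos : 0 < a j ^ 2 + b j ^ 2 := lt_of_le_of_ne (by positivity) hj.symm
    rw [← Finset.add_sum_erase _ _ (Finset.mem_univ j), pow_zero] at h1
    have hnn : ∀ i ∈ Finset.univ.erase j, 0 ≤ a i ^ 2 + b i ^ 2 := fun i _ => by positivity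
    have hrest : ∑ i ∈ Finset.univ.erase j, (a i ^ 2 + b i ^ 2) = 0 := by
      linarith [Finset.sum_nonneg hnn]
    have hzero : ∀ i, i ≠ j → a i = 0 ∧ b i = 0 := fun i hi => by
      have h0 := (Finset.sum_eq_zero_iff_of_nonneg hnn).mp hrest i (by simp [hi])
      exact ⟨by nlinarith [sq_nonneg (a i), sq_nonneg (b i)],
        by nlinarith [sq_nonneg (a i), sq_nonneg (b i)]⟩
    rw [Finset.sum_eq_single j (fun i _ hi => by simp [hzero i hi]) (by simp)] at h2
    rw [hrest, add_zero] at h1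
    have hb : b j * (2 * a j + b j) = 0 := by linear_combination h2
    rcases mul_eq_zero.mp hb with hb | hb
    · rw [hb] at h1
      exact ⟨j, by simpa using h1, hb, hzero⟩
    · obtain hb : b j = -2 * a j := by linarith
      rw [hb] at h1
      have : 5 * (a j ^ 2) = 1 := by linarith
      omega
  obtain ⟨j, haj, hbj, hij⟩ := hsingle
  have hoff : ∀ i, i ≠ j → goldVec a b 0 i = 0 := fun i hi => by simp [goldVec, hij i hi]
  rcases haj with haj | haj
  · refine ⟨1, one_mem _, j, ?_, fun i _ => Matrix.one_mulVec _⟩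
    funext i
    by_cases hi : i = j
    · subst hi
      simp [goldVec, haj, hbj]
    · simp [hoff i hi, hi]
  · obtain ⟨r, hr, hrm⟩ := exists_mem_HinfG_reflMat (single_mem_rootSet j)
    refine ⟨r, hr, j, ?_, fun i hi => ?_⟩
    · rw [hrm]
      funext i
      rw [reflMat_mulVec]
      by_cases hi : i = j
      · subst hi
        simp [goldVec, haj, hbj, Pi.single_apply]
        norm_num
      · simp [hoff i hi, hi]
    · rw [hrm]
      apply reflMat_mulVec_of_eq_zero
      have : i ≠ j := by
        rintro rfl
        simp [goldVec, haj, hbj] at hi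
      simp [this]

theorem exists_mulVec_eq_single {v : Fin 4 → ℝ} (hv : ∑ i, v i * v i = 1)
    (hmem : ∀ i, v i ∈ goldSubring) :
    ∃ h ∈ HinfG, ∃ j, h.1.mulVec v = Pi.single j 1 ∧
      ∀ i, v i = 0 → h.1.mulVec (Pi.single i 1) = Pi.single i 1 := by
  have main : ∀ (n : ℕ) (a b : Fin 4 → ℤ), ∑ i, goldVec a b n i * goldVec a b n i = 1 →
      ∃ h ∈ HinfG, ∃ j, h.1.mulVec (goldVec a b n) = Pi.single j 1 ∧
        ∀ i, goldVec a b n i = 0 → h.1.mulVec (Pi.single i 1) = Pi.single i 1 := by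
    intro n
    induction n with
    | zero => exact fun a b h => exists_mulVec_goldVec_zero h
    | succ n ih =>
      intro a b hab
      obtain ⟨h, hh, c, d, hcd, hfix⟩ := exists_mulVec_goldVec hab
      obtain ⟨k, hk, j, hj, hfix'⟩ := ih c d (hcd ▸ sum_mulVec_mul_self h hab)
      refine ⟨k * h, mul_mem hk hh, j, by rw [mul_mulVec, hcd, hj], fun i hi => ?_⟩
      rw [mul_mulVec, hfix i hi]
      exact hfix' i (hcd ▸ apply_eq_zero_of_mulVec (hfix i hi) hi)
  choose a b m hm using hmem
  have : v = goldVec (fun i => a i * 2 ^ (∑ j ∈ Finset.univ.erase i, m j))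
      (fun i => b i * 2 ^ (∑ j ∈ Finset.univ.erase i, m j)) (∑ j, m j) := by
    funext i
    rw [hm i, goldVec, ← Finset.add_sum_erase _ _ (Finset.mem_univ i), pow_add]
    push_cast
    field_simp
  rw [this] at hv ⊢
  exact main _ _ _ hv

theorem mulVec_mem_goldSubring {M : Matrix (Fin 4) (Fin 4) ℝ} {v : Fin 4 → ℝ}
    (hM : ∀ i j, M i j ∈ goldSubring) (hv : ∀ j, v j ∈ goldSubring) (i : Fin 4) :
    M.mulVec v i ∈ goldSubring := by
  rw [Matrix.mulVec, dotProduct]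
  exact sum_mem fun j _ => mul_mem (hM i j) (hv j)

theorem HinfG_apply_mem {g : Matrix.orthogonalGroup (Fin 4) ℝ} (hg : g ∈ HinfG) (i j : Fin 4) :
    g.1 i j ∈ goldSubring := by
  induction hg using Subgroup.closure_induction generalizing i j with
  | mem g hg =>
    obtain ⟨a, ha, hga⟩ := hg
    rw [hga, reflMat, Matrix.of_apply]
    refine sub_mem ?_ (mul_mem (mul_mem ?_ (rootSet_mem ha i)) (rootSet_mem ha j))
    · split_ifs
      · exact one_mem _
      · exact zero_mem _
    · exact ofNat_mem _ 2
  | one =>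
    change (1 : Matrix (Fin 4) (Fin 4) ℝ) i j ∈ goldSubring
    rw [Matrix.one_apply]
    split_ifs
    · exact one_mem _
    · exact zero_mem _
  | mul g h _ _ ihg ihh => exact mulVec_mem_goldSubring ihg (fun k => ihh k j) i
  | inv g _ ih => exact ih j i

/-- The orthogonal matrices over the dyadic golden numbers, as a subgroup. -/
def goldOrthogonal : Subgroup (Matrix.orthogonalGroup (Fin 4) ℝ) where
  carrier := O4R
  one_mem' := fun i j => HinfG_apply_mem (one_mem _) i j
  mul_mem' := fun {_ _} hg hh i j =>
    mulVec_mem_goldSubring hg (fun k => hh k j) i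
  inv_mem' := fun {_} hg i j => hg j i

theorem HinfG_le_goldOrthogonal : HinfG ≤ goldOrthogonal := fun _ hg => HinfG_apply_mem hg

/-- `Σ` consists of all unit vectors with dyadic golden coordinates. -/
theorem mem_SigmaSet_iff {v : Fin 4 → ℝ} :
    v ∈ SigmaSet ↔ ∑ i, v i * v i = 1 ∧ ∀ i, v i ∈ goldSubring := by
  constructor
  · rintro ⟨g, hg, a, ha, rfl⟩
    exact ⟨sum_mulVec_mul_self g (rootSet_norm ha),
      mulVec_mem_goldSubring (HinfG_apply_mem hg) (rootSet_mem ha)⟩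
  · rintro ⟨hv, hmem⟩
    obtain ⟨h, hh, j, hj, -⟩ := exists_mulVec_eq_single hv hmem
    refine ⟨h⁻¹, inv_mem hh, Pi.single j 1, single_mem_rootSet j, ?_⟩
    rw [← hj, ← mul_mulVec, inv_mul_cancel]
    exact (Matrix.one_mulVec v).symm

theorem mulVec_mem_SigmaSet {g : Matrix.orthogonalGroup (Fin 4) ℝ} (hg : g ∈ goldOrthogonal)
    {v : Fin 4 → ℝ} (hv : v ∈ SigmaSet) : g.1.mulVec v ∈ SigmaSet := by
  rw [mem_SigmaSet_iff] at hv ⊢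
  exact ⟨sum_mulVec_mul_self g hv.1, mulVec_mem_goldSubring hg hv.2⟩

theorem OSigma_eq_O4R : OSigma = O4R := by
  ext g
  constructor
  · intro hg i j
    have hj : Pi.single j (1 : ℝ) ∈ SigmaSet :=
      ⟨1, one_mem _, _, single_mem_rootSet j, (Matrix.one_mulVec _).symm⟩
    have h : g.1.mulVec (Pi.single j 1) ∈ SigmaSet := hg ▸ Set.mem_image_of_mem _ hj
    have := (mem_SigmaSet_iff.mp h).2 i
    rwa [Matrix.mulVec_single_one] at this
  · intro hg
    refine Set.Subset.antisymm ?_ fun v hv => ⟨(g⁻¹).1.mulVec v, ?_, ?_⟩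
    · rintro _ ⟨v, hv, rfl⟩
      exact mulVec_mem_SigmaSet hg hv
    · exact mulVec_mem_SigmaSet (goldOrthogonal.inv_mem hg) hv
    · change g.1.mulVec ((g⁻¹).1.mulVec v) = v
      rw [← mul_mulVec, mul_inv_cancel]
      exact Matrix.one_mulVec v

/-! ### Reduction to `1` or `ι` -/

theorem iotaM_mem : iotaM ∈ Matrix.orthogonalGroup (Fin 4) ℝ := by
  rw [Matrix.mem_orthogonalGroup_iff]
  ext i j
  fin_cases i <;> fin_cases j <;>
    simp [iotaM, Matrix.mul_apply, Fin.sum_univ_four]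

/-- `ι` as an element of the orthogonal group. -/
def iotaG : Matrix.orthogonalGroup (Fin 4) ℝ := ⟨iotaM, iotaM_mem⟩

/-- The cyclic permutation of three coordinates is a product of two reflections in roots. -/
theorem exists_mem_HinfG_cycle :
    (∃ h ∈ HinfG, h.1.mulVec (Pi.single 0 1) = Pi.single 0 1 ∧
      h.1.mulVec (Pi.single 1 1) = Pi.single 2 1 ∧ h.1.mulVec (Pi.single 2 1) = Pi.single 3 1 ∧
      h.1.mulVec (Pi.single 3 1) = Pi.single 1 1) ∧
    (∃ h ∈ HinfG, h.1.mulVec (Pi.single 0 1) = Pi.single 1 1 ∧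
      h.1.mulVec (Pi.single 1 1) = Pi.single 2 1 ∧
      h.1.mulVec (Pi.single 2 1) = Pi.single 0 1) := by
  have hsgn : ∀ k : Fin 4, ∀ i : Fin 4, (if i = k then (-1 : ℝ) else 1) = 1 ∨
      (if i = k then (-1 : ℝ) else 1) = -1 := fun k i => by split_ifs <;> simp
  have root : ∀ (p : Fin 4 → Fin 4) (hp : Function.Injective p) (k : Fin 4),
      ∃ h ∈ HinfG, (h : Matrix (Fin 4) (Fin 4) ℝ) = reflMat fun i =>
        (if i = k then (-1 : ℝ) else 1) * (![0, 1, 1 - gr, gr] (p i)) / 2 := fun p hp k =>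
    exists_mem_HinfG_reflMat (signed_perm_mem_rootSet
      (Equiv.ofBijective p (Finite.injective_iff_bijective.mp hp)) _ (hsgn k))
  constructor
  · obtain ⟨r, hr, hrm⟩ := root ![0, 1, 2, 3] (by decide) 1
    obtain ⟨s, hs, hsm⟩ := root ![0, 3, 1, 2] (by decide) 2
    refine ⟨r * s, mul_mem hr hs, ?_, ?_, ?_, ?_⟩ <;>
    · rw [mul_mulVec, hrm, hsm]
      funext i
      simp only [reflMat_mulVec, Fin.sum_univ_four, Pi.single_apply]
      fin_cases i <;> simp <;> grind [gr_sq]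
  · obtain ⟨r, hr, hrm⟩ := root ![1, 2, 3, 0] (by decide) 0
    obtain ⟨s, hs, hsm⟩ := root ![3, 1, 2, 0] (by decide) 1
    refine ⟨r * s, mul_mem hr hs, ?_, ?_, ?_⟩ <;>
    · rw [mul_mulVec, hrm, hsm]
      funext i
      simp only [reflMat_mulVec, Fin.sum_univ_four, Pi.single_apply]
      fin_cases i <;> simp <;> grind [gr_sq]

/-- One column of a dyadic golden orthogonal matrix can be turned into a standard basis vector
without changing the columns which are standard basis vectors already. -/
theorem exists_mul_mulVec_single {g : Matrix.orthogonalGroup (Fin 4) ℝ} (hg : g ∈ goldOrthogonal)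
    (k : Fin 4) :
    ∃ h ∈ HinfG, ∃ j, (h * g).1.mulVec (Pi.single k 1) = Pi.single j 1 ∧
      ∀ m i, m ≠ k → g.1.mulVec (Pi.single m 1) = Pi.single i 1 →
        (h * g).1.mulVec (Pi.single m 1) = Pi.single i 1 := by
  have hk := mem_SigmaSet_iff.mp (mulVec_mem_SigmaSet hg
    (mem_SigmaSet_iff.mpr ⟨rootSet_norm (single_mem_rootSet k), rootSet_mem (single_mem_rootSet k)⟩))
  obtain ⟨h, hh, j, hj, hfix⟩ := exists_mulVec_eq_single hk.1 hk.2
  refine ⟨h, hh, j, by rw [mul_mulVec, hj], fun m i hmk hm => ?_⟩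
  rw [mul_mulVec, hm]
  apply hfix
  have := mulVec_dotProduct_mulVec g (Pi.single k 1) (Pi.single m 1)
  rwa [hm, dotProduct_single_one, dotProduct_single_one, Pi.single_eq_of_ne hmk] at this

theorem mulVec_single_ne {g : Matrix.orthogonalGroup (Fin 4) ℝ} {m k i j : Fin 4} (hmk : m ≠ k)
    (hm : g.1.mulVec (Pi.single m 1) = Pi.single i 1)
    (hk : g.1.mulVec (Pi.single k 1) = Pi.single j 1) : i ≠ j := by
  rintro rfl
  have := mulVec_dotProduct_mulVec g (Pi.single k 1) (Pi.single m 1)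
  rw [hm, hk, dotProduct_single_one, dotProduct_single_one, Pi.single_eq_of_ne hmk] at this
  simp at this

theorem exists_mem_HinfG_to_zero (j : Fin 4) :
    ∃ h ∈ HinfG, h.1.mulVec (Pi.single j 1) = Pi.single 0 1 := by
  obtain ⟨⟨c, hc, -, -, -, c3⟩, d, hd, -, d1, d2⟩ := exists_mem_HinfG_cycle
  fin_cases j
  · exact ⟨1, one_mem _, Matrix.one_mulVec _⟩
  · exact ⟨d * d, mul_mem hd hd, by simp only [mul_mulVec, Fin.mk_one, d1, d2]⟩
  · exact ⟨d, hd, d2⟩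
  · exact ⟨d * d * c, mul_mem (mul_mem hd hd) hc, by
      simp only [mul_mulVec, Fin.reduceFinMk, c3, d1, d2]⟩

theorem exists_mem_HinfG_to_one {j : Fin 4} (hj : j ≠ 0) :
    ∃ h ∈ HinfG, h.1.mulVec (Pi.single j 1) = Pi.single 1 1 ∧
      h.1.mulVec (Pi.single 0 1) = Pi.single 0 1 := by
  obtain ⟨⟨c, hc, c0, -, c2, c3⟩, -⟩ := exists_mem_HinfG_cycle
  fin_cases j
  · simp at hj
  · exact ⟨1, one_mem _, Matrix.one_mulVec _, Matrix.one_mulVec _⟩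
  · exact ⟨c * c, mul_mem hc hc, by simp only [mul_mulVec, Fin.reduceFinMk, c2, c3],
      by simp only [mul_mulVec, c0]⟩
  · exact ⟨c, hc, c3, c0⟩

theorem eq_of_mulVec_single {g h : Matrix.orthogonalGroup (Fin 4) ℝ}
    (H : ∀ i, g.1.mulVec (Pi.single i 1) = h.1.mulVec (Pi.single i 1)) : g = h :=
  Subtype.ext (Matrix.ext_of_mulVec_single H)

theorem exists_mul_eq_one_or_iotaG {g : Matrix.orthogonalGroup (Fin 4) ℝ}
    (hg : g ∈ goldOrthogonal) : ∃ h ∈ HinfG, h * g = 1 ∨ h * g = iotaG := by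
  have step : ∀ h ∈ HinfG, h * g ∈ goldOrthogonal := fun h hh =>
    mul_mem (HinfG_le_goldOrthogonal hh) hg
  obtain ⟨h, hh, j, hj, -⟩ := exists_mul_mulVec_single hg 0
  obtain ⟨k, hk, hk0⟩ := exists_mem_HinfG_to_zero j
  obtain ⟨a, ha, a0⟩ : ∃ a ∈ HinfG, (a * g).1.mulVec (Pi.single 0 1) = Pi.single 0 1 :=
    ⟨k * h, mul_mem hk hh, by rw [mul_assoc, mul_mulVec, hj, hk0]⟩
  obtain ⟨h, hh, j, hj, hfix⟩ := exists_mul_mulVec_single (step a ha) 1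
  have h0 := hfix 0 0 (by decide) a0
  obtain ⟨k, hk, hk1, hk0⟩ := exists_mem_HinfG_to_one
    (mulVec_single_ne (by decide : (0 : Fin 4) ≠ 1) h0 hj).symm
  obtain ⟨b, hb, b0, b1⟩ : ∃ b ∈ HinfG, (b * g).1.mulVec (Pi.single 0 1) = Pi.single 0 1 ∧
      (b * g).1.mulVec (Pi.single 1 1) = Pi.single 1 1 := by
    refine ⟨k * (h * a), mul_mem hk (mul_mem hh ha), ?_, ?_⟩
    · rw [mul_assoc, mul_assoc, mul_mulVec, h0, hk0]
    · rw [mul_assoc, mul_assoc, mul_mulVec, hj, hk1]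
  obtain ⟨h, hh, j, c2, hfix⟩ := exists_mul_mulVec_single (step b hb) 2
  have c0 := hfix 0 0 (by decide) b0
  have c1 := hfix 1 1 (by decide) b1
  rw [← mul_assoc] at c0 c1 c2
  obtain ⟨h', hh', l, d3, hfix'⟩ := exists_mul_mulVec_single (step _ (mul_mem hh hb)) 3
  have d0 := hfix' 0 0 (by decide) c0
  have d1 := hfix' 1 1 (by decide) c1
  have d2 := hfix' 2 j (by decide) c2
  have n1 := mulVec_single_ne (by decide) d0 d2
  have n2 := mulVec_single_ne (by decide) d1 d2
  have n3 := mulVec_single_ne (by decide) d0 d3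
  have n4 := mulVec_single_ne (by decide) d1 d3
  have n5 := mulVec_single_ne (by decide) d2 d3
  refine ⟨h' * (h * b), mul_mem hh' (mul_mem hh hb), ?_⟩
  rw [mul_assoc]
  have hjl : (j = 2 ∧ l = 3) ∨ (j = 3 ∧ l = 2) := by omega
  rcases hjl with ⟨rfl, rfl⟩ | ⟨rfl, rfl⟩
  · left
    apply eq_of_mulVec_single
    intro i
    refine Eq.trans ?_ (Matrix.one_mulVec _).symm
    fin_cases i
    exacts [d0, d1, d2, d3]
  · right
    apply eq_of_mulVec_single
    have : ∀ i, iotaG.1.mulVec (Pi.single i 1) = Pi.single (Equiv.swap 2 3 i) 1 := by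
      intro i
      funext j
      rw [Matrix.mulVec_single_one]
      change iotaM j i = _
      fin_cases i <;> fin_cases j <;> simp [iotaM, Equiv.swap_apply_def]
    intro i
    rw [this]
    fin_cases i
    exacts [d0, d1, d2, d3]

theorem iotaG_mul_iotaG : iotaG * iotaG = 1 := by
  apply Subtype.ext
  change iotaM * iotaM = 1
  ext i j
  fin_cases i <;> fin_cases j <;>
    simp [iotaM, Matrix.mul_apply, Fin.sum_univ_four]

theorem mem_HinfG_or_eq_iotaG_mul {g : Matrix.orthogonalGroup (Fin 4) ℝ}
    (hg : g ∈ goldOrthogonal) : g ∈ HinfG ∨ ∃ h ∈ HinfG, g = iotaG * h := by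
  obtain ⟨h, hh, h1 | h1⟩ := exists_mul_eq_one_or_iotaG (inv_mem hg)
  · left
    rwa [← eq_of_mul_inv_eq_one h1]
  · right
    refine ⟨h, hh, ?_⟩
    rw [← mul_left_inj g⁻¹, mul_assoc, h1, mul_inv_cancel, iotaG_mul_iotaG]

theorem iotaG_mem_goldOrthogonal : iotaG ∈ goldOrthogonal := by
  intro i j
  change iotaM i j ∈ goldSubring
  fin_cases i <;> fin_cases j <;> simp [iotaM]

/-! ### The invariant separating `ι` from `H∞` -/

open scoped Quaternion

/-- The quaternion with the given vector of coordinates. -/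
def toQuat (v : Fin 4 → ℝ) : ℍ[ℝ] := ⟨v 0, v 1, v 2, v 3⟩

@[simp] theorem toQuat_re (v : Fin 4 → ℝ) : (toQuat v).re = v 0 := rfl

@[simp] theorem toQuat_imI (v : Fin 4 → ℝ) : (toQuat v).imI = v 1 := rfl

@[simp] theorem toQuat_imJ (v : Fin 4 → ℝ) : (toQuat v).imJ = v 2 := rfl

@[simp] theorem toQuat_imK (v : Fin 4 → ℝ) : (toQuat v).imK = v 3 := rfl

/-- Unit quaternions with dyadic golden coordinates. -/
structure IsGoldUnit (p : ℍ[ℝ]) : Prop where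
  re : p.re ∈ goldSubring
  imI : p.imI ∈ goldSubring
  imJ : p.imJ ∈ goldSubring
  imK : p.imK ∈ goldSubring
  norm : p * star p = 1

namespace IsGoldUnit

theorem one : IsGoldUnit 1 :=
  ⟨by simp, by simp, by simp, by simp, by simp⟩

theorem neg {p : ℍ[ℝ]} (hp : IsGoldUnit p) : IsGoldUnit (-p) :=
  ⟨by simpa using hp.re, by simpa using hp.imI, by simpa using hp.imJ, by simpa using hp.imK,
    by simpa using hp.norm⟩

theorem star {p : ℍ[ℝ]} (hp : IsGoldUnit p) : IsGoldUnit (star p) :=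
  ⟨by simpa using hp.re, by simpa using hp.imI, by simpa using hp.imJ, by simpa using hp.imK,
    by rw [star_star, Quaternion.star_mul_self, ← Quaternion.self_mul_star, hp.norm]⟩

theorem star_mul_self {p : ℍ[ℝ]} (hp : IsGoldUnit p) : Star.star p * p = 1 := by
  simpa using hp.star.norm

theorem mul {p q : ℍ[ℝ]} (hp : IsGoldUnit p) (hq : IsGoldUnit q) : IsGoldUnit (p * q) := by
  have m := fun {x y : ℝ} (hx : x ∈ goldSubring) (hy : y ∈ goldSubring) => mul_mem hx hy
  refine ⟨?_, ?_, ?_, ?_, ?_⟩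
  · rw [Quaternion.re_mul]
    exact sub_mem (sub_mem (sub_mem (m hp.re hq.re) (m hp.imI hq.imI)) (m hp.imJ hq.imJ))
      (m hp.imK hq.imK)
  · rw [Quaternion.imI_mul]
    exact sub_mem (add_mem (add_mem (m hp.re hq.imI) (m hp.imI hq.re)) (m hp.imJ hq.imK))
      (m hp.imK hq.imJ)
  · rw [Quaternion.imJ_mul]
    exact add_mem (add_mem (sub_mem (m hp.re hq.imJ) (m hp.imI hq.imK)) (m hp.imJ hq.re))
      (m hp.imK hq.imI)
  · rw [Quaternion.imK_mul]
    exact add_mem (sub_mem (add_mem (m hp.re hq.imK) (m hp.imI hq.imJ)) (m hp.imJ hq.imI))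
      (m hp.imK hq.re)
  · rw [star_mul, mul_assoc, ← mul_assoc q, hq.norm, one_mul, hp.norm]

end IsGoldUnit

theorem toQuat_reflMat_mulVec {a : Fin 4 → ℝ} (ha : ∑ i, a i * a i = 1) (v : Fin 4 → ℝ) :
    toQuat ((reflMat a).mulVec v) = -toQuat a * star (toQuat v) * toQuat a := by
  simp only [Fin.sum_univ_four] at ha
  ext <;> simp [reflMat_mulVec, Fin.sum_univ_four]
  · linear_combination -v 0 * ha
  · linear_combination -v 1 * ha
  · linear_combination -v 2 * ha
  · linear_combination -v 3 * ha

/-- Every element of `H∞` has the form `x ↦ p x q` or `x ↦ p x̄ q` with dyadic golden unit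
quaternions `p` and `q`. -/
theorem HinfG_quaternion {g : Matrix.orthogonalGroup (Fin 4) ℝ} (hg : g ∈ HinfG) :
    ∃ p q : ℍ[ℝ], IsGoldUnit p ∧ IsGoldUnit q ∧
      ((∀ v, toQuat (g.1.mulVec v) = p * toQuat v * q) ∨
        ∀ v, toQuat (g.1.mulVec v) = p * star (toQuat v) * q) := by
  induction hg using Subgroup.closure_induction with
  | mem g hg =>
    obtain ⟨a, ha, hga⟩ := hg
    have hu : IsGoldUnit (toQuat a) := by
      refine ⟨rootSet_mem ha 0, rootSet_mem ha 1, rootSet_mem ha 2, rootSet_mem ha 3, ?_⟩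
      have h1 := rootSet_norm ha
      rw [Fin.sum_univ_four] at h1
      rw [Quaternion.self_mul_star, Quaternion.normSq_def']
      simp only [toQuat_re, toQuat_imI, toQuat_imJ, toQuat_imK, pow_two, h1, Quaternion.coe_one]
    refine ⟨-toQuat a, toQuat a, hu.neg, hu, Or.inr fun v => ?_⟩
    rw [hga, toQuat_reflMat_mulVec (rootSet_norm ha)]
  | one =>
    refine ⟨1, 1, .one, .one, Or.inl fun v => ?_⟩
    rw [one_mul, mul_one]
    exact congrArg toQuat (Matrix.one_mulVec v)
  | mul g h _ _ ihg ihh =>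
    obtain ⟨p, q, hp, hq, hpq⟩ := ihg
    obtain ⟨r, s, hr, hs, hrs⟩ := ihh
    rcases hpq with hpq | hpq <;> rcases hrs with hrs | hrs
    · exact ⟨p * r, s * q, hp.mul hr, hs.mul hq, Or.inl fun v => by
        simp only [mul_mulVec, hpq, hrs, mul_assoc]⟩
    · exact ⟨p * r, s * q, hp.mul hr, hs.mul hq, Or.inr fun v => by
        simp only [mul_mulVec, hpq, hrs, mul_assoc]⟩
    · exact ⟨p * star s, star r * q, hp.mul hs.star, hr.star.mul hq, Or.inr fun v => by
        simp only [mul_mulVec, hpq, hrs, mul_assoc, star_mul]⟩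
    · exact ⟨p * star s, star r * q, hp.mul hs.star, hr.star.mul hq, Or.inl fun v => by
        simp only [mul_mulVec, hpq, hrs, mul_assoc, star_mul, star_star]⟩
  | inv g _ ih =>
    obtain ⟨p, q, hp, hq, hpq⟩ := ih
    have hgv : ∀ v, g.1.mulVec ((g⁻¹).1.mulVec v) = v := fun v => by
      rw [← mul_mulVec, mul_inv_cancel]
      exact Matrix.one_mulVec v
    have cancel : ∀ x, star p * (p * x * q) * star q = x := fun x => by
      rw [mul_assoc p, ← mul_assoc (star p), hp.star_mul_self, one_mul, mul_assoc, hq.norm, mul_one]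
    rcases hpq with hpq | hpq
    · refine ⟨star p, star q, hp.star, hq.star, Or.inl fun v => ?_⟩
      conv_rhs => rw [← hgv v, hpq, cancel]
    · refine ⟨q, p, hq, hp, Or.inr fun v => ?_⟩
      have := cancel (star (toQuat ((g⁻¹).1.mulVec v)))
      rw [← hpq, hgv] at this
      rw [← star_star (toQuat ((g⁻¹).1.mulVec v)), ← this]
      simp [mul_assoc]

theorem iotaG_notMem_HinfG : iotaG ∉ HinfG := by
  intro h
  obtain ⟨p, q, hp, hq, hpq⟩ := HinfG_quaternion h
  have hval : ∀ v, toQuat (iotaG.1.mulVec v) = toQuat ![v 0, v 1, v 3, v 2] := by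
    intro v
    change toQuat (iotaM.mulVec v) = _
    ext <;> simp [iotaM, dotProduct, Fin.sum_univ_four]
  have hnorm := hp.norm
  rw [Quaternion.self_mul_star, Quaternion.normSq_def'] at hnorm
  have hnorm' : p.re ^ 2 + p.imI ^ 2 + p.imJ ^ 2 + p.imK ^ 2 = 1 :=
    Quaternion.coe_injective (by rw [hnorm, Quaternion.coe_one])
  simp only [hval] at hpq
  have hone : toQuat ![1, 0, 0, 0] = 1 := by ext <;> simp
  have hpq1 : p * q = 1 := by
    rcases hpq with hpq | hpq
    all_goals
      have := hpq ![1, 0, 0, 0]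
      rw [hone] at this
      simp only [star_one, mul_one] at this
      rw [← this]
      ext <;> simp
  have hqp : q * p = 1 := by
    have : q = star p := by
      rw [← one_mul q, ← hp.star_mul_self, mul_assoc, hpq1, mul_one]
    rw [this, hp.star_mul_self]
  have hmul : ∀ x y : ℍ[ℝ], y = p * x * q → y * p = p * x := fun x y hxy => by
    rw [hxy, mul_assoc, hqp, mul_one]
  rcases hpq with hpq | hpq
  · have e1 := hmul _ _ (hpq ![0, 1, 0, 0])
    have e2 := hmul _ _ (hpq ![0, 0, 1, 0])
    have e3 := hmul _ _ (hpq ![0, 0, 0, 1])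
    simp [Quaternion.ext_iff] at e1 e2 e3
    obtain ⟨_, _⟩ := e1
    obtain ⟨_, _, _, _⟩ := e2
    obtain ⟨_, _, _, _⟩ := e3
    have h0 : p.re = 0 := by linarith
    have h1 : p.imI = 0 := by linarith
    have h2 : p.imJ = 0 := by linarith
    have h3 : p.imK = 0 := by linarith
    simp [h0, h1, h2, h3] at hnorm'
  · have e1 := hmul _ _ (hpq ![0, 1, 0, 0])
    have e2 := hmul _ _ (hpq ![0, 0, 1, 0])
    have e3 := hmul _ _ (hpq ![0, 0, 0, 1])
    simp [Quaternion.ext_iff] at e1 e2 e3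
    obtain ⟨_, _⟩ := e1
    obtain ⟨_, _, _, _⟩ := e2
    obtain ⟨_, _, _, _⟩ := e3
    have h0 : p.re = 0 := by linarith
    have h1 : p.imI = 0 := by linarith
    have h2 : p.imK = -p.imJ := by linarith
    apply two_mul_self_ne_one_of_mem hp.imJ
    rw [h0, h1, h2] at hnorm'
    linarith

theorem O4R_eq_closure :
    O4R = (Subgroup.closure ((HinfG : Set (Matrix.orthogonalGroup (Fin 4) ℝ)) ∪
      {g | (g : Matrix (Fin 4) (Fin 4) ℝ) = iotaM}) :
        Subgroup (Matrix.orthogonalGroup (Fin 4) ℝ)) := by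
  apply Set.Subset.antisymm
  · intro g hg
    have hι : iotaG ∈ Subgroup.closure ((HinfG : Set (Matrix.orthogonalGroup (Fin 4) ℝ)) ∪
        {g | (g : Matrix (Fin 4) (Fin 4) ℝ) = iotaM}) := Subgroup.subset_closure (Or.inr rfl)
    rcases mem_HinfG_or_eq_iotaG_mul hg with h | ⟨h, hh, rfl⟩
    · exact Subgroup.subset_closure (Or.inl h)
    · exact mul_mem hι (Subgroup.subset_closure (Or.inl hh))
  · change _ ≤ goldOrthogonal
    rw [Subgroup.closure_le]
    rintro g (hg | hg)
    · exact HinfG_le_goldOrthogonal hg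
    · obtain rfl : g = iotaG := Subtype.ext hg
      exact iotaG_mem_goldOrthogonal

theorem statement19 :
    OSigma = O4R ∧
    (O4R = (Subgroup.closure ((HinfG : Set (Matrix.orthogonalGroup (Fin 4) ℝ)) ∪
        {g | (g : Matrix (Fin 4) (Fin 4) ℝ) = iotaM}) :
        Subgroup (Matrix.orthogonalGroup (Fin 4) ℝ)) ∧
      (∀ g : Matrix.orthogonalGroup (Fin 4) ℝ,
        (g : Matrix (Fin 4) (Fin 4) ℝ) = iotaM → g ∉ HinfG)) ∧
    (∃ g₀ : Matrix.orthogonalGroup (Fin 4) ℝ,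
      (g₀ : Matrix (Fin 4) (Fin 4) ℝ) = iotaM ∧ g₀ ∉ HinfG ∧
      ∀ g ∈ O4R, g ∈ HinfG ∨ ∃ h ∈ HinfG, g = g₀ * h) := by
  have unique : ∀ g : Matrix.orthogonalGroup (Fin 4) ℝ,
      (g : Matrix (Fin 4) (Fin 4) ℝ) = iotaM → g ∉ HinfG := fun g hg h =>
    iotaG_notMem_HinfG ((Subtype.ext hg : g = iotaG) ▸ h)
  exact ⟨OSigma_eq_O4R, ⟨O4R_eq_closure, unique⟩, iotaG, rfl, iotaG_notMem_HinfG,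
    fun g hg => mem_HinfG_or_eq_iotaG_mul hg⟩
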